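/- Let q = 2^r with r a positive integer and let β ∈ 𝔽_q. Then the number of w ∈ SO⁺(4,q) with matrix trace Tr w = β equals q³(2q² − q − 2) if β = 0, and equals q²(q(q+1)(q−2) + K(λ;β^{−1})) if β ≠ 0. -/

import Mathlib

open Finset Matrix

/-- The quadratic form `θ⁺(x) = ∑ i, x_i x_{n+i}` on `F^{2n}` (columns indexed by `Fin n ⊕ Fin n`). -/
def thetaPlus (F : Type) [Field F] (n : ℕ) (x : Fin n ⊕ Fin n → F) : F :=
  ∑ i : Fin n, x (Sum.inl i) * x (Sum.inr i)

/-- The orthogonal group `O⁺(2n,q)`: invertible matrices preserving `θ⁺`. -/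
noncomputable def OplusGrp (F : Type) [Field F] [Fintype F] [DecidableEq F] (n : ℕ) :
    Finset (Matrix (Fin n ⊕ Fin n) (Fin n ⊕ Fin n) F) := by
  classical
  exact Finset.univ.filter (fun w => IsUnit w ∧
    ∀ x : Fin n ⊕ Fin n → F, thetaPlus F n (w.mulVec x) = thetaPlus F n x)

/-- `SO⁺(2n,q)`: the kernel of `δ⁺(w) = Tr(B ᵗC)` on `O⁺(2n,q)`,
where `w = [[A,B],[C,D]]` in `n × n` blocks. -/
noncomputable def SOplusGrp (F : Type) [Field F] [Fintype F] [DecidableEq F] (n : ℕ) :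
    Finset (Matrix (Fin n ⊕ Fin n) (Fin n ⊕ Fin n) F) := by
  classical
  exact (OplusGrp F n).filter
    (fun w => Matrix.trace (Matrix.toBlocks₁₂ w * (Matrix.toBlocks₂₁ w)ᵀ) = 0)

/-- The trace map `tr(x) = x + x² + ⋯ + x^{2^{r−1}}`, valued in `𝔽₂ = {0,1} ⊆ F`. -/
def trF (F : Type) [Field F] (r : ℕ) (x : F) : F := ∑ i ∈ Finset.range r, x ^ 2 ^ i

/-- The canonical additive character `λ(x) = (−1)^{tr(x)} ∈ {±1} ⊆ ℤ`. -/
noncomputable def lam (F : Type) [Field F] (r : ℕ) (x : F) : ℤ := by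
  classical exact if trF F r x = 0 then 1 else -1

/-- The trace map `tr` viewed as a function into `𝔽₂ = ZMod 2`. -/
noncomputable def tr2 (F : Type) [Field F] (r : ℕ) (x : F) : ZMod 2 := by
  classical exact if trF F r x = 0 then 0 else 1

/-- The Kloosterman sum `K(λ;a) = ∑_{α ∈ F*} λ(α + aα⁻¹)`. -/
noncomputable def Kl (F : Type) [Field F] [Fintype F] (r : ℕ) (a : F) : ℤ := by
  classical
  exact ∑ α ∈ Finset.univ.filter (fun α : F => α ≠ 0), lam F r (α + a * α⁻¹)

/-- The `m`-dimensional Kloosterman sum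
`K_m(λ;a) = ∑_{α₁,…,α_m ∈ F*} λ(α₁ + ⋯ + α_m + aα₁⁻¹⋯α_m⁻¹)`;
for `m = 0` this is `K₀(λ;a) = λ(a)`. -/
noncomputable def Klm (F : Type) [Field F] [Fintype F] (r m : ℕ) (a : F) : ℤ := by
  classical
  exact ∑ v ∈ Finset.univ.filter (fun v : Fin m → F => ∀ i, v i ≠ 0),
    lam F r ((∑ i, v i) + a * (∏ i, v i)⁻¹)

/-- The power moment `MK^h = ∑_{a ∈ F*} K(λ;a)^h`. -/
noncomputable def MK (F : Type) [Field F] [Fintype F] (r h : ℕ) : ℤ := by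
  classical exact ∑ a ∈ Finset.univ.filter (fun a : F => a ≠ 0), (Kl F r a) ^ h

/-- The power moment `MK₂^h = ∑_{a ∈ F*} K₂(λ;a)^h` of 2-dimensional Kloosterman sums. -/
noncomputable def MK2 (F : Type) [Field F] [Fintype F] (r h : ℕ) : ℤ := by
  classical exact ∑ a ∈ Finset.univ.filter (fun a : F => a ≠ 0), (Klm F r 2 a) ^ h

/-- The binary code `C(G) = {u ∈ 𝔽₂^G : ∑_{g ∈ G} u_g Tr(g) = 0 in F}`. -/
noncomputable def code (F : Type) [Field F] [Fintype F] [DecidableEq F]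
    {ι : Type} [Fintype ι] [DecidableEq ι] (G : Finset (Matrix ι ι F)) :
    Finset (↥G → ZMod 2) := by
  classical
  exact Finset.univ.filter
    (fun u => ∑ g : ↥G, (u g).val • Matrix.trace (g : Matrix ι ι F) = 0)

/-- Number of codewords of Hamming weight `j` in the code `C(G)`. -/
noncomputable def wtCount (F : Type) [Field F] [Fintype F] [DecidableEq F]
    {ι : Type} [Fintype ι] [DecidableEq ι] (G : Finset (Matrix ι ι F)) (j : ℕ) : ℕ := by
  classical
  exact ((code F G).filter
    (fun u => (Finset.univ.filter (fun g : ↥G => u g = 1)).card = j)).card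

/-- `t! · S(h,t)` where `S(h,t)` is the Stirling number of the second kind,
`S(h,t) = (1/t!) ∑_{j=0}^{t} (−1)^{t−j} C(t,j) j^h`. -/
def tS (h t : ℕ) : ℤ :=
  ∑ j ∈ Finset.range (t + 1), (-1 : ℤ) ^ (t - j) * (t.choose j : ℤ) * (j : ℤ) ^ h

/-- Binomial coefficient with integer arguments: `0` whenever `k < 0` or `k > n`. -/
def ichoose (n k : ℤ) : ℤ := if 0 ≤ k ∧ k ≤ n then (n.toNat.choose k.toNat : ℤ) else 0

section ArtinSchreier

variable {F : Type} [Field F] [CharP F 2]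

theorem trF_add (r : ℕ) (x y : F) : trF F r (x + y) = trF F r x + trF F r y := by
  simp only [trF, ← Finset.sum_add_distrib]
  exact Finset.sum_congr rfl fun i _ => add_pow_char_pow x y 2 i

theorem trF_sq_add_self (r : ℕ) (x : F) : trF F r (x ^ 2 + x) = x ^ 2 ^ r + x := by
  have key : ∀ i, (x ^ 2 + x) ^ 2 ^ i = x ^ 2 ^ (i + 1) - x ^ 2 ^ i := fun i => by
    rw [add_pow_char_pow, ← pow_mul, ← pow_succ', CharTwo.sub_eq_add]
  simp only [trF, key]
  rw [Finset.sum_range_sub (fun i => x ^ 2 ^ i), CharTwo.sub_eq_add]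
  simp

theorem trF_sq (r : ℕ) (x : F) : trF F r x ^ 2 = trF F r (x ^ 2) := by
  simp only [trF, sum_pow_char]
  exact Finset.sum_congr rfl fun i _ => by ring

variable [Fintype F] {r : ℕ} (hF : Fintype.card F = 2 ^ r)
include hF

theorem trF_eq_zero_or_one (x : F) : trF F r x = 0 ∨ trF F r x = 1 := by
  have h : trF F r x ^ 2 + trF F r x = 0 := by
    rw [trF_sq, ← trF_add, trF_sq_add_self, ← hF, FiniteField.pow_card, CharTwo.add_self_eq_zero]
  have h' : trF F r x * (trF F r x + 1) = 0 := by linear_combination h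
  rcases mul_eq_zero.mp h' with h0 | h1
  · exact Or.inl h0
  · exact Or.inr (CharTwo.add_eq_zero.mp h1)

theorem lam_add (x y : F) : lam F r (x + y) = lam F r x * lam F r y := by
  have hadd := trF_add r x y
  rcases trF_eq_zero_or_one hF x with hx | hx <;>
    rcases trF_eq_zero_or_one hF y with hy | hy <;>
    simp [lam, hadd, hx, hy, CharTwo.add_self_eq_zero]

open Polynomial in
omit [CharP F 2] hF in
theorem card_trF_eq_zero_le [DecidableEq F] (hr : 1 ≤ r) :
    (Finset.univ.filter fun x : F => trF F r x = 0).card ≤ 2 ^ (r - 1) := by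
  let P : F[X] := ∑ i ∈ Finset.range r, X ^ 2 ^ i
  have hdeg : P.natDegree ≤ 2 ^ (r - 1) := by
    refine natDegree_sum_le_of_forall_le _ _ fun i hi => ?_
    rw [natDegree_X_pow]
    exact Nat.pow_le_pow_right two_pos (Nat.le_sub_one_of_lt (Finset.mem_range.mp hi))
  have hP : P ≠ 0 := by
    intro h
    have h1 : P.coeff 1 = 1 := by
      simp only [P, finsetSum_coeff, coeff_X_pow]
      rw [Finset.sum_eq_single_of_mem 0 (Finset.mem_range.mpr hr)]
      · simp
      · intro i _ hi
        exact if_neg (Nat.one_lt_two_pow hi).ne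
    rw [h, coeff_zero] at h1
    exact zero_ne_one h1
  calc _ ≤ P.roots.toFinset.card := by
        refine Finset.card_le_card fun x hx => ?_
        rw [Multiset.mem_toFinset, mem_roots hP, IsRoot.def]
        simpa [P, eval_finsetSum, trF] using (Finset.mem_filter.mp hx).2
    _ ≤ P.roots.card := Multiset.toFinset_card_le _
    _ ≤ P.natDegree := P.card_roots'
    _ ≤ 2 ^ (r - 1) := hdeg

theorem card_sq_add_self_eq [DecidableEq F] (hr : 1 ≤ r) (c : F) :
    ((Finset.univ.filter fun z : F => z ^ 2 + z = c).card : ℤ) = 1 + lam F r c := by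
  let f : F → F := fun z => z ^ 2 + z
  have fiber : ∀ w, (Finset.univ.filter fun z => f z = f w).card = 2 := by
    intro w
    have : (Finset.univ.filter fun z => f z = f w) = {w, w + 1} := by
      ext z
      have h : f z = f w ↔ (z + w) * (z + (w + 1)) = 0 := by
        rw [← sub_eq_zero, CharTwo.sub_eq_add]
        have h2 : (2 : F) = 0 := CharTwo.two_eq_zero
        rw [show f z + f w = (z + w) * (z + (w + 1)) by linear_combination (-z * w) * h2]
      simp [h, CharTwo.add_eq_zero]
    rw [this, Finset.card_pair (by simp)]
  have himage : 2 ^ r = (Finset.univ.image f).card * 2 := by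
    rw [← hF, ← Finset.card_univ, Finset.card_eq_sum_card_image f]
    refine Finset.sum_const_nat fun b hb => ?_
    obtain ⟨w, -, rfl⟩ := Finset.mem_image.mp hb
    exact fiber w
  have hpow : 2 ^ r = 2 ^ (r - 1) * 2 := by rw [← pow_succ, Nat.sub_add_cancel hr]
  have heq : Finset.univ.image f = Finset.univ.filter fun x : F => trF F r x = 0 := by
    refine Finset.eq_of_subset_of_card_le ?_ ?_
    · intro b hb
      obtain ⟨w, -, rfl⟩ := Finset.mem_image.mp hb
      simp [f, trF_sq_add_self, ← hF, FiniteField.pow_card, CharTwo.add_self_eq_zero]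
    · have := card_trF_eq_zero_le (F := F) hr
      omega
  by_cases hc : trF F r c = 0
  · have : c ∈ Finset.univ.image f := by simpa [heq] using hc
    obtain ⟨w, -, rfl⟩ := Finset.mem_image.mp this
    simp only [lam, hc, if_true]
    exact_mod_cast fiber w
  · have : c ∉ Finset.univ.image f := by simpa [heq] using hc
    have h0 : (Finset.univ.filter fun z : F => z ^ 2 + z = c) = ∅ := by
      ext z
      simpa using fun hz => this (Finset.mem_image.mpr ⟨z, Finset.mem_univ _, hz⟩)
    simp [lam, hc, h0]

theorem sum_lam_eq_zero [DecidableEq F] (hr : 1 ≤ r) : ∑ c : F, lam F r c = 0 := by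
  have h := Finset.card_eq_sum_card_fiberwise (s := (Finset.univ : Finset F))
    (t := Finset.univ) (f := fun z => z ^ 2 + z) (by simp)
  have h' : (Fintype.card F : ℤ) = ∑ c : F, (1 + lam F r c) := by
    rw [← Finset.card_univ, h]
    push_cast
    exact Finset.sum_congr rfl fun c _ => card_sq_add_self_eq hF hr c
  rw [Finset.sum_add_distrib] at h'
  simpa using h'

theorem sum_lam_ne_zero [DecidableEq F] (hr : 1 ≤ r) :
    ∑ c ∈ Finset.univ.filter (fun c : F => c ≠ 0), lam F r c = -1 := by
  have h := sum_lam_eq_zero hF hr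
  rw [← Finset.add_sum_erase _ _ (Finset.mem_univ (0 : F))] at h
  have h0 : lam F r (0 : F) = 1 := by simp [lam, trF]
  rw [Finset.filter_ne']
  linarith

/-- The number of matrices in `SL(2,q)` with trace `t`. -/
def cardSLTrace (F : Type) [Field F] [Fintype F] [DecidableEq F] (t : F) : ℕ :=
  (Finset.univ.filter fun A : Matrix (Fin 2) (Fin 2) F => A.det = 1 ∧ A.trace = t).card

omit [CharP F 2] hF in
theorem card_mul_eq [DecidableEq F] (m : F) :
    ((Finset.univ.filter fun p : F × F => p.1 * p.2 = m).card : ℤ) =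
      (Fintype.card F - 1) + if m = 0 then (Fintype.card F : ℤ) else 0 := by
  have h : ∀ b : F, ((Finset.univ.filter fun c : F => b * c = m).card : ℤ) =
      if b = 0 then (if m = 0 then (Fintype.card F : ℤ) else 0) else 1 := by
    intro b
    by_cases hb : b = 0
    · by_cases hm : m = 0
      · simp [hb, hm]
      · simp [hb, hm, Ne.symm hm]
    · have : (Finset.univ.filter fun c : F => b * c = m) = {b⁻¹ * m} := by
        ext c
        simp [eq_inv_mul_iff_mul_eq₀ hb]
      simp [hb, this]
  have hsum : ((Finset.univ.filter fun p : F × F => p.1 * p.2 = m).card : ℤ) =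
      ∑ b : F, ((Finset.univ.filter fun c : F => b * c = m).card : ℤ) := by
    simp only [Finset.card_filter, ← Finset.univ_product_univ, Finset.sum_product]
    push_cast
    rfl
  rw [hsum, Finset.sum_congr rfl fun b _ => h b,
    ← Finset.add_sum_erase _ _ (Finset.mem_univ (0 : F)), if_pos rfl,
    Finset.sum_congr rfl fun b hb => if_neg (Finset.ne_of_mem_erase hb)]
  rw [Finset.sum_const, Finset.card_erase_of_mem (Finset.mem_univ _), Finset.card_univ,
    nsmul_eq_mul, mul_one, Nat.cast_sub Fintype.card_pos]
  push_cast
  ring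

theorem cardSLTrace_eq_card_roots [DecidableEq F] (t : F) :
    (cardSLTrace F t : ℤ) = 2 ^ r * (2 ^ r - 1) +
      2 ^ r * ((Finset.univ.filter fun a : F => a ^ 2 + t * a + 1 = 0).card : ℤ) := by
  have hcard : cardSLTrace F t =
      (Finset.univ.filter fun p : F × F × F => p.2.1 * p.2.2 = p.1 ^ 2 + t * p.1 + 1).card := by
    refine Finset.card_bij' (fun A _ => (A 0 0, A 0 1, A 1 0))
      (fun p _ => !![p.1, p.2.1; p.2.2, t + p.1]) ?_ ?_ ?_ ?_
    · intro A hA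
      simp only [Finset.mem_filter, Finset.mem_univ, true_and, det_fin_two, trace_fin_two] at hA ⊢
      obtain ⟨h1, h2⟩ := hA
      have h0 : (2 : F) = 0 := CharTwo.two_eq_zero
      linear_combination -h1 + A 0 0 * h2 - (A 0 0 ^ 2 + 1) * h0
    · rintro ⟨a, b, c⟩ h
      simp only [Finset.mem_filter, Finset.mem_univ, true_and] at h
      have h0 : (2 : F) = 0 := CharTwo.two_eq_zero
      simp only [Finset.mem_filter, Finset.mem_univ, true_and, det_fin_two_of, trace_fin_two_of]
      constructor
      · linear_combination -h - h0
      · linear_combination a * h0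
    · intro A hA
      simp only [Finset.mem_filter, Finset.mem_univ, true_and, trace_fin_two] at hA
      have h11 : t + A 0 0 = A 1 1 := by
        have h0 : (2 : F) = 0 := CharTwo.two_eq_zero
        linear_combination -hA.2 + A 0 0 * h0
      ext i j
      fin_cases i <;> fin_cases j <;> simp [h11]
    · rintro ⟨a, b, c⟩ _
      simp
  have hsum : ((Finset.univ.filter fun p : F × F × F =>
        p.2.1 * p.2.2 = p.1 ^ 2 + t * p.1 + 1).card : ℤ) =
      ∑ a : F, ((Finset.univ.filter fun p : F × F => p.1 * p.2 = a ^ 2 + t * a + 1).card : ℤ) := by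
    rw [Finset.card_filter, ← Finset.univ_product_univ, Finset.sum_product]
    simp only [Finset.card_filter]
    push_cast
    rfl
  rw [hcard, hsum, Finset.sum_congr rfl fun a _ => card_mul_eq _, Finset.sum_add_distrib,
    Finset.card_filter]
  push_cast
  rw [Finset.mul_sum]
  simp only [mul_ite, mul_one, mul_zero, Finset.sum_const, Finset.card_univ, hF, nsmul_eq_mul]
  push_cast
  rfl

theorem cardSLTrace_zero [DecidableEq F] : (cardSLTrace F 0 : ℤ) = (2 ^ r) ^ 2 := by
  have h : (Finset.univ.filter fun a : F => a ^ 2 + 0 * a + 1 = 0) = {1} := by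
    ext a
    have : a ^ 2 + 0 * a + 1 = (a + 1) ^ 2 := by
      have h0 : (2 : F) = 0 := CharTwo.two_eq_zero
      linear_combination -a * h0
    rw [Finset.mem_filter_univ, this, Finset.mem_singleton, pow_eq_zero_iff two_ne_zero,
      CharTwo.add_eq_zero]
  rw [cardSLTrace_eq_card_roots hF, h]
  simp
  ring

theorem cardSLTrace_of_ne_zero [DecidableEq F] (hr : 1 ≤ r) {t : F} (ht : t ≠ 0) :
    (cardSLTrace F t : ℤ) = (2 ^ r) ^ 2 + 2 ^ r * lam F r t⁻¹ := by
  have h : (Finset.univ.filter fun a : F => a ^ 2 + t * a + 1 = 0).card =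
      (Finset.univ.filter fun z : F => z ^ 2 + z = t⁻¹).card := by
    have h0 : (2 : F) = 0 := CharTwo.two_eq_zero
    refine Finset.card_bij' (fun a _ => t⁻¹ * (a + 1)) (fun z _ => t * z + 1) ?_ ?_ ?_ ?_
    · intro a ha
      simp only [Finset.mem_filter, Finset.mem_univ, true_and] at ha ⊢
      field_simp
      linear_combination ha + a * h0
    · intro z hz
      simp only [Finset.mem_filter, Finset.mem_univ, true_and] at hz ⊢
      field_simp at hz
      linear_combination t * hz + (1 + t + t * z) * h0
    · intro a _
      field_simp
      linear_combination h0
    · intro z _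
      field_simp
      linear_combination h0
  rw [cardSLTrace_eq_card_roots hF, h, card_sq_add_self_eq hF hr]
  ring

theorem sum_cardSLTrace_ne_zero [DecidableEq F] (hr : 1 ≤ r) :
    ∑ t ∈ Finset.univ.filter (fun t : F => t ≠ 0), (cardSLTrace F t : ℤ) =
      (2 ^ r) ^ 3 - (2 ^ r) ^ 2 - 2 ^ r := by
  have hinv : ∑ t ∈ Finset.univ.filter (fun t : F => t ≠ 0), lam F r t⁻¹ = -1 := by
    rw [← sum_lam_ne_zero hF hr]
    exact Finset.sum_nbij' (·⁻¹) (·⁻¹) (by simp) (by simp) (by simp) (by simp) (by simp)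
  rw [Finset.sum_congr rfl fun t ht =>
    cardSLTrace_of_ne_zero hF hr (Finset.mem_filter.mp ht).2, Finset.sum_add_distrib,
    ← Finset.mul_sum, hinv, Finset.sum_const, Finset.filter_ne',
    Finset.card_erase_of_mem (Finset.mem_univ _), Finset.card_univ, nsmul_eq_mul,
    Nat.cast_sub Fintype.card_pos, hF]
  push_cast
  ring

theorem sum_cardSLTrace_mul_zero [DecidableEq F] (hr : 1 ≤ r) :
    ∑ p ∈ Finset.univ.filter (fun p : F × F => p.1 * p.2 = 0),
      (cardSLTrace F p.1 * cardSLTrace F p.2 : ℤ) =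
      (2 ^ r) ^ 3 * (2 * (2 ^ r) ^ 2 - 2 ^ r - 2) := by
  have hsplit : (Finset.univ.filter fun p : F × F => p.1 * p.2 = 0) =
      (({0} : Finset F) ×ˢ ({0} : Finset F) ∪ ({0} : Finset F) ×ˢ Finset.univ.filter (fun t : F => t ≠ 0)) ∪
        Finset.univ.filter (fun t : F => t ≠ 0) ×ˢ ({0} : Finset F) := by
    ext ⟨s, t⟩
    simp
    tauto
  rw [hsplit, Finset.sum_union, Finset.sum_union]
  · simp only [Finset.sum_product, Finset.sum_singleton, ← Finset.mul_sum, ← Finset.sum_mul]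
    rw [sum_cardSLTrace_ne_zero hF hr, cardSLTrace_zero hF]
    ring
  · simp
  · rw [Finset.disjoint_left]
    rintro ⟨s, t⟩
    simp
    tauto

theorem sum_cardSLTrace_mul_of_ne_zero [DecidableEq F] (hr : 1 ≤ r) {β : F} (hβ : β ≠ 0) :
    ∑ p ∈ Finset.univ.filter (fun p : F × F => p.1 * p.2 = β),
      (cardSLTrace F p.1 * cardSLTrace F p.2 : ℤ) =
      (2 ^ r) ^ 2 * (2 ^ r * (2 ^ r + 1) * (2 ^ r - 2) + Kl F r β⁻¹) := by
  have hparam : ∑ p ∈ Finset.univ.filter (fun p : F × F => p.1 * p.2 = β),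
      (cardSLTrace F p.1 * cardSLTrace F p.2 : ℤ) =
      ∑ a ∈ Finset.univ.filter (fun a : F => a ≠ 0),
        ((2 ^ r) ^ 4 + (2 ^ r) ^ 3 * lam F r a + (2 ^ r) ^ 3 * lam F r (β⁻¹ * a⁻¹) +
          (2 ^ r) ^ 2 * lam F r (a + β⁻¹ * a⁻¹)) := by
    symm
    refine Finset.sum_bij' (fun a _ => (a⁻¹, β * a)) (fun p _ => p.1⁻¹) ?_ ?_ ?_ ?_ ?_
    · intro a ha
      have : a ≠ 0 := by simpa using ha
      simp only [Finset.mem_filter, Finset.mem_univ, true_and]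
      field_simp
    · rintro ⟨s, t⟩ hp
      simp only [Finset.mem_filter, Finset.mem_univ, true_and] at hp ⊢
      rintro h
      simp [inv_eq_zero.mp h, hβ.symm] at hp
    · simp
    · rintro ⟨s, t⟩ hp
      simp only [Finset.mem_filter, Finset.mem_univ, true_and] at hp
      have hs : s ≠ 0 := by
        rintro rfl
        simp [hβ.symm] at hp
      simp only [inv_inv, Prod.mk.injEq, true_and]
      rw [← hp]
      field_simp
    · intro a ha
      have ha : a ≠ 0 := by simpa using ha
      rw [cardSLTrace_of_ne_zero hF hr (inv_ne_zero ha),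
        cardSLTrace_of_ne_zero hF hr (mul_ne_zero hβ ha), inv_inv, mul_inv, lam_add hF]
      ring
  have hscale : ∑ a ∈ Finset.univ.filter (fun a : F => a ≠ 0), lam F r (β⁻¹ * a⁻¹) = -1 := by
    rw [← sum_lam_ne_zero hF hr]
    refine Finset.sum_nbij' (fun a => β⁻¹ * a⁻¹) (fun a => β⁻¹ * a⁻¹) ?_ ?_ ?_ ?_ ?_ <;>
      simp +contextual [hβ, mul_comm _ β]
  have hKl : ∑ a ∈ Finset.univ.filter (fun a : F => a ≠ 0), lam F r (a + β⁻¹ * a⁻¹) =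
      Kl F r β⁻¹ := by
    unfold Kl
    congr
  rw [hparam]
  simp only [Finset.sum_add_distrib, ← Finset.mul_sum]
  rw [hscale, hKl, sum_lam_ne_zero hF hr, Finset.sum_const, Finset.filter_ne',
    Finset.card_erase_of_mem (Finset.mem_univ _), Finset.card_univ, nsmul_eq_mul,
    Nat.cast_sub Fintype.card_pos, hF]
  push_cast
  ring

end ArtinSchreier

section TensorProduct

/-- The entries of a `2 × 2` matrix in the order in which the determinant becomes `θ⁺`
(in characteristic two). -/
def entryEquiv : Fin 2 ⊕ Fin 2 ≃ Fin 2 × Fin 2 where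
  toFun := Sum.elim ![(0, 0), (0, 1)] ![(1, 1), (1, 0)]
  invFun p := !![Sum.inl 0, Sum.inl 1; Sum.inr 1, Sum.inr 0] p.1 p.2
  left_inv := by decide
  right_inv := by decide

open Kronecker in
/-- The matrix of `M ↦ A M ᵗB` on `2 × 2` matrices. -/
def tensorMat {F : Type} [Field F] (A B : Matrix (Fin 2) (Fin 2) F) :
    Matrix (Fin 2 ⊕ Fin 2) (Fin 2 ⊕ Fin 2) F :=
  (A ⊗ₖ B).submatrix entryEquiv entryEquiv

variable {F : Type} [Field F]

theorem tensorMat_apply (A B : Matrix (Fin 2) (Fin 2) F) (i j : Fin 2 ⊕ Fin 2) :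
    tensorMat A B i j =
      A (entryEquiv i).1 (entryEquiv j).1 * B (entryEquiv i).2 (entryEquiv j).2 := rfl

theorem tensorMat_mul (A B A' B' : Matrix (Fin 2) (Fin 2) F) :
    tensorMat A B * tensorMat A' B' = tensorMat (A * A') (B * B') := by
  rw [tensorMat, tensorMat, submatrix_mul_equiv, ← mul_kronecker_mul, tensorMat]

theorem tensorMat_one : tensorMat (1 : Matrix (Fin 2) (Fin 2) F) 1 = 1 := by
  rw [tensorMat, one_kronecker_one, submatrix_one_equiv]

theorem trace_tensorMat (A B : Matrix (Fin 2) (Fin 2) F) :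
    (tensorMat A B).trace = A.trace * B.trace := by
  rw [← trace_kronecker]
  exact entryEquiv.sum_comp fun p => kroneckerMap (· * ·) A B p p

theorem tensorMat_smul_smul_inv (A B : Matrix (Fin 2) (Fin 2) F) {c : F} (hc : c ≠ 0) :
    tensorMat (c • A) (c⁻¹ • B) = tensorMat A B := by
  ext i j
  simp only [tensorMat_apply, Matrix.smul_apply, smul_eq_mul]
  field_simp

theorem isUnit_tensorMat {A B : Matrix (Fin 2) (Fin 2) F} (h : A.det * B.det = 1) :
    IsUnit (tensorMat A B) := by
  have hA : IsUnit A.det := IsUnit.of_mul_eq_one _ h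
  have hB : IsUnit B.det := IsUnit.of_mul_eq_one_right _ h
  refine IsUnit.of_mul_eq_one (tensorMat A⁻¹ B⁻¹) ?_
  rw [tensorMat_mul, mul_nonsing_inv _ hA, mul_nonsing_inv _ hB, tensorMat_one]

variable [CharP F 2]

theorem thetaPlus_tensorMat {A B : Matrix (Fin 2) (Fin 2) F} (h : A.det * B.det = 1)
    (x : Fin 2 ⊕ Fin 2 → F) :
    thetaPlus F 2 ((tensorMat A B).mulVec x) = thetaPlus F 2 x := by
  have h0 : (2 : F) = 0 := CharTwo.two_eq_zero
  rw [det_fin_two, det_fin_two] at h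
  simp [thetaPlus, mulVec, dotProduct, Fin.sum_univ_two, tensorMat_apply, entryEquiv]
  grind

theorem delta_tensorMat {A B : Matrix (Fin 2) (Fin 2) F} :
    ((tensorMat A B).toBlocks₁₂ * (tensorMat A B).toBlocks₂₁ᵀ).trace = 0 := by
  have h0 : (2 : F) = 0 := CharTwo.two_eq_zero
  simp [trace, mul_apply, Fin.sum_univ_two, tensorMat_apply, entryEquiv, toBlocks₁₂, toBlocks₂₁]
  linear_combination (A 0 1 * B 0 1 * A 1 0 * B 1 0 + A 0 1 * B 0 0 * A 1 0 * B 1 1) * h0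

theorem tensorMat_injective {A B A' B' : Matrix (Fin 2) (Fin 2) F}
    (hA : A.det = 1) (hB : B.det = 1) (hA' : A'.det = 1)
    (h : tensorMat A B = tensorMat A' B') : A = A' ∧ B = B' := by
  have key : ∀ i j k l, A i j * B k l = A' i j * B' k l := fun i j k l => by
    simpa [tensorMat_apply] using
      congr_fun₂ h (entryEquiv.symm (i, k)) (entryEquiv.symm (j, l))
  have exists_ne : ∀ M : Matrix (Fin 2) (Fin 2) F, M.det = 1 → ∃ k l, M k l ≠ 0 := by
    intro M hM
    by_contra! hz
    simp [det_fin_two, hz] at hM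
  obtain ⟨k, l, hkl⟩ := exists_ne B hB
  have hsmul : A = (B' k l * (B k l)⁻¹) • A' := by
    ext i j
    rw [Matrix.smul_apply, smul_eq_mul]
    have := key i j k l
    field_simp
    linear_combination this
  have hc : B' k l * (B k l)⁻¹ = 1 := by
    have hdet := congr_arg det hsmul
    rw [det_smul, hA, hA', Fintype.card_fin, mul_one] at hdet
    have hsq : (B' k l * (B k l)⁻¹ + 1) ^ 2 = 0 := by
      have h0 : (2 : F) = 0 := CharTwo.two_eq_zero
      linear_combination -hdet + (B' k l * (B k l)⁻¹ + 1) * h0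
    exact CharTwo.add_eq_zero.mp (pow_eq_zero_iff two_ne_zero |>.mp hsq)
  rw [hc, one_smul] at hsmul
  refine ⟨hsmul, ?_⟩
  obtain ⟨i, j, hij⟩ := exists_ne A hA
  ext k l
  have := key i j k l
  rw [← hsmul] at this
  exact mul_left_cancel₀ hij this

/-- A vector with `θ⁺ = 0` is a pure tensor. -/
theorem exists_pure_of_thetaPlus_eq_zero {x : Fin 2 ⊕ Fin 2 → F} (hx : thetaPlus F 2 x = 0) :
    ∃ u v : Fin 2 → F, ∀ i, x i = u (entryEquiv i).1 * v (entryEquiv i).2 := by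
  have h0 : (2 : F) = 0 := CharTwo.two_eq_zero
  rw [thetaPlus, Fin.sum_univ_two] at hx
  by_cases h : x (.inl 0) = 0
  · rw [h, zero_mul, zero_add] at hx
    rcases mul_eq_zero.mp hx with h1 | h1
    · refine ⟨![0, 1], ![x (.inr 1), x (.inr 0)], ?_⟩
      rintro (i | i) <;> fin_cases i <;> simp [entryEquiv, h, h1]
    · refine ⟨![x (.inl 1), x (.inr 0)], ![0, 1], ?_⟩
      rintro (i | i) <;> fin_cases i <;> simp [entryEquiv, h, h1]
  · refine ⟨![x (.inl 0), x (.inr 1)], ![1, x (.inl 1) * (x (.inl 0))⁻¹], ?_⟩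
    rintro (i | i) <;> fin_cases i <;> simp [entryEquiv] <;> field_simp
    linear_combination hx - x (.inl 1) * x (.inr 1) * h0

omit [CharP F 2] in
theorem thetaPlus_col {w : Matrix (Fin 2 ⊕ Fin 2) (Fin 2 ⊕ Fin 2) F}
    (hw : ∀ x, thetaPlus F 2 (w.mulVec x) = thetaPlus F 2 x) (j : Fin 2 ⊕ Fin 2) :
    thetaPlus F 2 (fun i => w i j) = 0 := by
  have h := hw (Pi.single j 1)
  rw [mulVec_single_one] at h
  change thetaPlus F 2 (fun i => w i j) = _ at h
  rw [h, thetaPlus, Fin.sum_univ_two]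
  rcases j with j | j <;> simp

omit [CharP F 2] in
theorem thetaPlus_col_add_col {w : Matrix (Fin 2 ⊕ Fin 2) (Fin 2 ⊕ Fin 2) F}
    (hw : ∀ x, thetaPlus F 2 (w.mulVec x) = thetaPlus F 2 x) (j k : Fin 2 ⊕ Fin 2) :
    thetaPlus F 2 (fun i => w i j + w i k) = thetaPlus F 2 (Pi.single j 1 + Pi.single k 1) := by
  have h := hw (Pi.single j 1 + Pi.single k 1)
  rwa [mulVec_add, mulVec_single_one, mulVec_single_one] at h

omit [CharP F 2] in
/-- An isometry of `θ⁺` fixing the first hyperbolic pair is a tensor product, possibly after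
exchanging the vectors of the second pair. -/
theorem exists_tensorMat_of_fixes_pair {w : Matrix (Fin 2 ⊕ Fin 2) (Fin 2 ⊕ Fin 2) F}
    (hw : ∀ x, thetaPlus F 2 (w.mulVec x) = thetaPlus F 2 x)
    (h1 : ∀ i, w i (Sum.inl 0) = (1 : Matrix (Fin 2 ⊕ Fin 2) (Fin 2 ⊕ Fin 2) F) i (Sum.inl 0))
    (h3 : ∀ i, w i (Sum.inr 0) = (1 : Matrix (Fin 2 ⊕ Fin 2) (Fin 2 ⊕ Fin 2) F) i (Sum.inr 0)) :
    ∃ A B : Matrix (Fin 2) (Fin 2) F, A.det * B.det = 1 ∧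
      (w = tensorMat A B ∨
        w = (tensorMat A B).submatrix id (Equiv.swap (Sum.inl 1) (Sum.inr 1))) := by
  have h11 := h1 (Sum.inl 0)
  have h12 := h1 (Sum.inl 1)
  have h13 := h1 (Sum.inr 0)
  have h14 := h1 (Sum.inr 1)
  have h31 := h3 (Sum.inl 0)
  have h32 := h3 (Sum.inl 1)
  have h33 := h3 (Sum.inr 0)
  have h34 := h3 (Sum.inr 1)
  have q2 := thetaPlus_col hw (Sum.inl 1)
  have q4 := thetaPlus_col hw (Sum.inr 1)
  have b12 := thetaPlus_col_add_col hw (Sum.inl 0) (Sum.inl 1)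
  have b14 := thetaPlus_col_add_col hw (Sum.inl 0) (Sum.inr 1)
  have b32 := thetaPlus_col_add_col hw (Sum.inr 0) (Sum.inl 1)
  have b34 := thetaPlus_col_add_col hw (Sum.inr 0) (Sum.inr 1)
  have b24 := thetaPlus_col_add_col hw (Sum.inl 1) (Sum.inr 1)
  simp [one_apply] at h11 h12 h13 h14 h31 h32 h33 h34
  simp [thetaPlus, Fin.sum_univ_two, h11, h12, h13, h14, h31, h32, h33, h34]
    at q2 q4 b12 b14 b32 b34 b24
  have z32 : w (Sum.inr 0) (Sum.inl 1) = 0 := by linear_combination b12 - q2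
  have z34 : w (Sum.inr 0) (Sum.inr 1) = 0 := by linear_combination b14 - q4
  have z12 : w (Sum.inl 0) (Sum.inl 1) = 0 := by linear_combination b32 - q2
  have z14 : w (Sum.inl 0) (Sum.inr 1) = 0 := by linear_combination b34 - q4
  simp only [z32, z34, z12, z14, mul_zero, zero_add, mul_eq_zero] at q2 q4 b24
  rcases q2 with q2 | q2 <;> rcases q4 with q4 | q4 <;>
    simp only [q2, q4, zero_mul, mul_zero, zero_add, add_zero, zero_ne_one] at b24
  · refine ⟨!![1, 0; 0, w (Sum.inr 1) (Sum.inl 1)], !![1, 0; 0, w (Sum.inl 1) (Sum.inr 1)],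
      by simpa [mul_comm] using b24, Or.inr ?_⟩
    ext (i | i) (j | j) <;> fin_cases i <;> fin_cases j <;>
      simp [tensorMat_apply, entryEquiv, Equiv.swap_apply_def, *]
    linear_combination -b24
  · refine ⟨!![1, 0; 0, w (Sum.inr 1) (Sum.inr 1)], !![1, 0; 0, w (Sum.inl 1) (Sum.inl 1)],
      by simpa [mul_comm] using b24, Or.inl ?_⟩
    ext (i | i) (j | j) <;> fin_cases i <;> fin_cases j <;>
      simp [tensorMat_apply, entryEquiv, *]
    linear_combination -b24

theorem exists_tensorMat_of_isometry {w : Matrix (Fin 2 ⊕ Fin 2) (Fin 2 ⊕ Fin 2) F}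
    (hw : ∀ x, thetaPlus F 2 (w.mulVec x) = thetaPlus F 2 x) :
    ∃ A B : Matrix (Fin 2) (Fin 2) F, A.det * B.det = 1 ∧
      (w = tensorMat A B ∨
        w = (tensorMat A B).submatrix id (Equiv.swap (Sum.inl 1) (Sum.inr 1))) := by
  obtain ⟨u, v, huv⟩ := exists_pure_of_thetaPlus_eq_zero (thetaPlus_col hw (Sum.inl 0))
  obtain ⟨u', v', huv'⟩ := exists_pure_of_thetaPlus_eq_zero (thetaPlus_col hw (Sum.inr 0))
  let A : Matrix (Fin 2) (Fin 2) F := !![u 0, u' 0; u 1, u' 1]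
  let B : Matrix (Fin 2) (Fin 2) F := !![v 0, v' 0; v 1, v' 1]
  have hdet : A.det * B.det = 1 := by
    have h0 : (2 : F) = 0 := CharTwo.two_eq_zero
    have b := thetaPlus_col_add_col hw (Sum.inl 0) (Sum.inr 0)
    simp only [huv, huv'] at b
    simp [thetaPlus, Fin.sum_univ_two, entryEquiv] at b
    simp only [A, B, det_fin_two_of]
    grind
  have hA : IsUnit A.det := IsUnit.of_mul_eq_one _ hdet
  have hB : IsUnit B.det := IsUnit.of_mul_eq_one_right _ hdet
  have hleft : tensorMat A⁻¹ B⁻¹ * tensorMat A B = 1 := by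
    rw [tensorMat_mul, nonsing_inv_mul _ hA, nonsing_inv_mul _ hB, tensorMat_one]
  have hright : tensorMat A B * tensorMat A⁻¹ B⁻¹ = 1 := by
    rw [tensorMat_mul, mul_nonsing_inv _ hA, mul_nonsing_inv _ hB, tensorMat_one]
  have hdet_inv : A⁻¹.det * B⁻¹.det = 1 := by
    rw [← det_mul, ← Matrix.mul_inv_rev, det_nonsing_inv, det_mul, mul_comm, hdet, Ring.inverse_one]
  have col : ∀ j, (∀ i, w i j = tensorMat A B i j) →
      ∀ i, (tensorMat A⁻¹ B⁻¹ * w) i j = (1 : Matrix (Fin 2 ⊕ Fin 2) (Fin 2 ⊕ Fin 2) F) i j := by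
    intro j hj i
    rw [← hleft, mul_apply, mul_apply]
    exact Finset.sum_congr rfl fun k _ => by rw [hj k]
  obtain ⟨A₂, B₂, hdet₂, hw₂⟩ := exists_tensorMat_of_fixes_pair
    (w := tensorMat A⁻¹ B⁻¹ * w)
    (fun x => by rw [← mulVec_mulVec, thetaPlus_tensorMat hdet_inv, hw])
    (col _ fun i => by
      rw [huv, tensorMat_apply]
      rcases i with i | i <;> fin_cases i <;> simp [entryEquiv, A, B])
    (col _ fun i => by
      rw [huv', tensorMat_apply]
      rcases i with i | i <;> fin_cases i <;> simp [entryEquiv, A, B])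
  have hw_eq : w = tensorMat A B * (tensorMat A⁻¹ B⁻¹ * w) := by
    rw [← Matrix.mul_assoc, hright, Matrix.one_mul]
  refine ⟨A * A₂, B * B₂, ?_, ?_⟩
  · rw [det_mul, det_mul]
    linear_combination A₂.det * B₂.det * hdet + hdet₂
  · rw [← tensorMat_mul]
    rcases hw₂ with h | h
    · exact Or.inl (by rw [← h, ← hw_eq])
    · exact Or.inr (by rw [hw_eq, h]; rfl)

theorem delta_tensorMat_swap {A B : Matrix (Fin 2) (Fin 2) F} (h : A.det * B.det = 1) :
    (((tensorMat A B).submatrix id (Equiv.swap (Sum.inl 1) (Sum.inr 1))).toBlocks₁₂ *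
      ((tensorMat A B).submatrix id (Equiv.swap (Sum.inl 1) (Sum.inr 1))).toBlocks₂₁ᵀ).trace
        = 1 := by
  have h0 : (2 : F) = 0 := CharTwo.two_eq_zero
  rw [det_fin_two, det_fin_two] at h
  simp [trace, mul_apply, Fin.sum_univ_two, tensorMat_apply, entryEquiv, toBlocks₁₂, toBlocks₂₁,
    Equiv.swap_apply_def]
  grind

variable [Fintype F]

theorem exists_det_one_tensorMat_eq {A B : Matrix (Fin 2) (Fin 2) F} (h : A.det * B.det = 1) :
    ∃ A' B' : Matrix (Fin 2) (Fin 2) F,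
      A'.det = 1 ∧ B'.det = 1 ∧ tensorMat A' B' = tensorMat A B := by
  obtain ⟨c, hc⟩ := FiniteField.isSquare_of_char_two (ringChar.eq F 2) B.det
  have hc0 : c ≠ 0 := by
    rintro rfl
    simp [hc] at h
  refine ⟨c • A, c⁻¹ • B, ?_, ?_, tensorMat_smul_smul_inv A B hc0⟩
  · rw [det_smul, Fintype.card_fin]
    linear_combination h - A.det * hc
  · rw [det_smul, Fintype.card_fin, hc]
    field_simp

theorem mem_SOplusGrp_two_iff [DecidableEq F] (w : Matrix (Fin 2 ⊕ Fin 2) (Fin 2 ⊕ Fin 2) F) :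
    w ∈ SOplusGrp F 2 ↔ ∃ A B : Matrix (Fin 2) (Fin 2) F,
      A.det = 1 ∧ B.det = 1 ∧ tensorMat A B = w := by
  simp only [SOplusGrp, OplusGrp, Finset.mem_filter, Finset.mem_univ, true_and]
  constructor
  · rintro ⟨⟨-, hw⟩, hδ⟩
    obtain ⟨A, B, hdet, rfl | rfl⟩ := exists_tensorMat_of_isometry hw
    · exact exists_det_one_tensorMat_eq hdet
    · rw [delta_tensorMat_swap hdet] at hδ
      exact absurd hδ one_ne_zero
  · rintro ⟨A, B, hA, hB, rfl⟩
    have h : A.det * B.det = 1 := by rw [hA, hB, mul_one]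
    exact ⟨⟨isUnit_tensorMat h, thetaPlus_tensorMat h⟩, delta_tensorMat⟩

theorem card_SOplusGrp_trace [DecidableEq F] (β : F) :
    ((SOplusGrp F 2).filter fun w => w.trace = β).card =
      ∑ p ∈ Finset.univ.filter (fun p : F × F => p.1 * p.2 = β),
        cardSLTrace F p.1 * cardSLTrace F p.2 := by
  let S : Finset (Matrix (Fin 2) (Fin 2) F × Matrix (Fin 2) (Fin 2) F) :=
    Finset.univ.filter fun P => (P.1.det = 1 ∧ P.2.det = 1) ∧ P.1.trace * P.2.trace = β
  have himage : ((SOplusGrp F 2).filter fun w => w.trace = β) =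
      S.image fun P => tensorMat P.1 P.2 := by
    ext w
    simp only [S, Finset.mem_filter, mem_SOplusGrp_two_iff, Finset.mem_image, Finset.mem_univ,
      true_and, Prod.exists]
    constructor
    · rintro ⟨⟨A, B, hA, hB, rfl⟩, ht⟩
      exact ⟨A, B, ⟨⟨hA, hB⟩, by rwa [trace_tensorMat] at ht⟩, rfl⟩
    · rintro ⟨A, B, ⟨⟨hA, hB⟩, ht⟩, rfl⟩
      exact ⟨⟨A, B, hA, hB, rfl⟩, by rwa [trace_tensorMat]⟩
  rw [himage, Finset.card_image_of_injOn]
  · rw [Finset.card_eq_sum_card_fiberwise (f := fun P => (P.1.trace, P.2.trace))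
      (t := Finset.univ.filter fun p : F × F => p.1 * p.2 = β)]
    · refine Finset.sum_congr rfl fun p hp => ?_
      rw [cardSLTrace, cardSLTrace, ← Finset.card_product]
      congr 1
      ext ⟨A, B⟩
      simp only [Finset.mem_filter, Finset.mem_univ, true_and] at hp
      simp only [S, Finset.mem_filter, Finset.mem_univ, true_and, Finset.mem_product]
      constructor
      · rintro ⟨⟨⟨hA, hB⟩, -⟩, rfl⟩
        exact ⟨⟨hA, rfl⟩, hB, rfl⟩
      · rintro ⟨⟨hA, hA'⟩, hB, hB'⟩
        exact ⟨⟨⟨hA, hB⟩, by rw [hA', hB', hp]⟩, by rw [hA', hB']⟩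
    · intro P hP
      simpa [S] using (Finset.mem_filter.mp hP).2.2
  · rintro ⟨A, B⟩ hP ⟨A', B'⟩ hP' h
    have hP := (Finset.mem_filter.mp hP).2.1
    have hP' := (Finset.mem_filter.mp hP').2.1
    exact Prod.ext_iff.mpr (tensorMat_injective hP.1 hP.2 hP'.1 h)

end TensorProduct

theorem stmt12 (r : ℕ) (hr : 1 ≤ r) (F : Type) [Field F] [Fintype F] [DecidableEq F]
    (hF : Fintype.card F = 2 ^ r) (β : F) :
    (β = 0 → (((SOplusGrp F 2).filter (fun w => Matrix.trace w = β)).card : ℤ) =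
      (2 ^ r : ℤ) ^ 3 * (2 * (2 ^ r : ℤ) ^ 2 - (2 ^ r : ℤ) - 2)) ∧
    (β ≠ 0 → (((SOplusGrp F 2).filter (fun w => Matrix.trace w = β)).card : ℤ) =
      (2 ^ r : ℤ) ^ 2 *
        ((2 ^ r : ℤ) * ((2 ^ r : ℤ) + 1) * ((2 ^ r : ℤ) - 2) + Kl F r β⁻¹)) := by
  have h2 : (2 : F) = 0 := by
    have h := Nat.cast_card_eq_zero F
    rw [hF, Nat.cast_pow] at h
    exact_mod_cast eq_zero_of_pow_eq_zero h
  have : CharP F 2 := CharTwo.of_one_ne_zero_of_two_eq_zero one_ne_zero h2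
  rw [card_SOplusGrp_trace]
  push_cast
  refine ⟨?_, fun hβ => sum_cardSLTrace_mul_of_ne_zero hF hr hβ⟩
  rintro rfl
  exact sum_cardSLTrace_mul_zero hF hr
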